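/- (Relative wage effects of automation versus capital accumulation) For every K > 0, L > 0 and Φ ∈ (0,1), with k = K/Φ, ℓ = L/(1−Φ) and κ = Φ/(1−Φ), the mixed second partial derivatives of F satisfy F_{LΦ}(K,L;Φ) = [ (σ/(1−σ))·(k/ℓ)^((1−σ)/σ) − (κ + 1/(1−σ)) ]·k·F_{KL}(K,L;Φ). -/

import Mathlib

/-- Region-1 CES production function. -/
noncomputable def F (A σ K L Φ : ℝ) : ℝ :=
  A * (K ^ ((σ - 1) / σ) * Φ ^ (1 / σ) + L ^ ((σ - 1) / σ) * (1 - Φ) ^ (1 / σ)) ^ (σ / (σ - 1))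

/-- Return to capital: partial derivative of `F` with respect to `K`. -/
noncomputable def FK (A σ K L Φ : ℝ) : ℝ := deriv (fun K' => F A σ K' L Φ) K

/-- Wage: partial derivative of `F` with respect to `L`. -/
noncomputable def FL (A σ K L Φ : ℝ) : ℝ := deriv (fun L' => F A σ K L' Φ) L

/-- Mixed second partial derivative of `F` with respect to `K` and `L`. -/
noncomputable def FKL (A σ K L Φ : ℝ) : ℝ := deriv (fun L' => FK A σ K L' Φ) L

/-- Mixed second partial derivative of `F` with respect to `L` and `Φ`. -/
noncomputable def FLΦ (A σ K L Φ : ℝ) : ℝ := deriv (fun Φ' => FL A σ K L Φ') Φ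

theorem hasDerivAt_one_sub_rpow {Φ : ℝ} (hΦ1 : Φ < 1) (q : ℝ) :
    HasDerivAt (fun Φ' : ℝ => (1 - Φ') ^ q) (-(q * (1 - Φ) ^ (q - 1))) Φ := by
  have h := ((hasDerivAt_id Φ).const_sub 1).rpow_const (p := q) (Or.inl (sub_pos.2 hΦ1).ne')
  exact h.congr_deriv (by simp)

/-- The CES aggregate inside the outer power of `F`. -/
noncomputable def cesAggregate (σ K L Φ : ℝ) : ℝ :=
  K ^ ((σ - 1) / σ) * Φ ^ (1 / σ) + L ^ ((σ - 1) / σ) * (1 - Φ) ^ (1 / σ)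

theorem cesAggregate_pos {σ K L Φ : ℝ} (hK : 0 < K) (hL : 0 < L) (hΦ0 : 0 < Φ) (hΦ1 : Φ < 1) :
    0 < cesAggregate σ K L Φ := by
  have : 0 < 1 - Φ := sub_pos.2 hΦ1
  unfold cesAggregate
  positivity

theorem hasDerivAt_cesAggregate_capital {σ K L Φ : ℝ} (hK : 0 < K) :
    HasDerivAt (fun K' => cesAggregate σ K' L Φ)
      ((σ - 1) / σ * K ^ ((σ - 1) / σ - 1) * Φ ^ (1 / σ)) K :=
  ((Real.hasDerivAt_rpow_const (Or.inl hK.ne')).mul_const _).add_const _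

theorem hasDerivAt_cesAggregate_labor {σ K L Φ : ℝ} (hL : 0 < L) :
    HasDerivAt (fun L' => cesAggregate σ K L' Φ)
      ((σ - 1) / σ * L ^ ((σ - 1) / σ - 1) * (1 - Φ) ^ (1 / σ)) L :=
  ((Real.hasDerivAt_rpow_const (Or.inl hL.ne')).mul_const _).const_add _

theorem hasDerivAt_cesAggregate_share {σ K L Φ : ℝ} (hΦ0 : 0 < Φ) (hΦ1 : Φ < 1) :
    HasDerivAt (fun Φ' => cesAggregate σ K L Φ')
      (K ^ ((σ - 1) / σ) * (1 / σ * Φ ^ (1 / σ - 1))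
        + L ^ ((σ - 1) / σ) * -(1 / σ * (1 - Φ) ^ (1 / σ - 1))) Φ :=
  ((Real.hasDerivAt_rpow_const (Or.inl hΦ0.ne')).const_mul _).add
    ((hasDerivAt_one_sub_rpow hΦ1 _).const_mul _)

theorem FK_eq {A σ K L Φ : ℝ} (hσ0 : 0 < σ) (hσ1 : σ < 1)
    (hK : 0 < K) (hL : 0 < L) (hΦ0 : 0 < Φ) (hΦ1 : Φ < 1) :
    FK A σ K L Φ = A * (K ^ ((σ - 1) / σ - 1) * Φ ^ (1 / σ))
      * cesAggregate σ K L Φ ^ (σ / (σ - 1) - 1) := by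
  have hS := cesAggregate_pos (σ := σ) hK hL hΦ0 hΦ1
  have h := ((hasDerivAt_cesAggregate_capital (σ := σ) (L := L) (Φ := Φ) hK).rpow_const
    (p := σ / (σ - 1)) (Or.inl hS.ne')).const_mul A
  have : σ - 1 ≠ 0 := (sub_neg.2 hσ1).ne
  refine h.deriv.trans ?_
  field_simp

theorem FL_eq {A σ K L Φ : ℝ} (hσ0 : 0 < σ) (hσ1 : σ < 1)
    (hK : 0 < K) (hL : 0 < L) (hΦ0 : 0 < Φ) (hΦ1 : Φ < 1) :
    FL A σ K L Φ = A * L ^ ((σ - 1) / σ - 1) * ((1 - Φ) ^ (1 / σ)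
      * cesAggregate σ K L Φ ^ (σ / (σ - 1) - 1)) := by
  have hS := cesAggregate_pos (σ := σ) hK hL hΦ0 hΦ1
  have h := ((hasDerivAt_cesAggregate_labor (σ := σ) (K := K) (Φ := Φ) hL).rpow_const
    (p := σ / (σ - 1)) (Or.inl hS.ne')).const_mul A
  have : σ - 1 ≠ 0 := (sub_neg.2 hσ1).ne
  refine h.deriv.trans ?_
  field_simp

theorem FKL_eq {A σ K L Φ : ℝ} (hσ0 : 0 < σ) (hσ1 : σ < 1)
    (hK : 0 < K) (hL : 0 < L) (hΦ0 : 0 < Φ) (hΦ1 : Φ < 1) :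
    FKL A σ K L Φ = A * (K ^ ((σ - 1) / σ - 1) * Φ ^ (1 / σ))
      * ((σ - 1) / σ * L ^ ((σ - 1) / σ - 1) * (1 - Φ) ^ (1 / σ) * (σ / (σ - 1) - 1)
        * cesAggregate σ K L Φ ^ (σ / (σ - 1) - 1 - 1)) := by
  have hS := cesAggregate_pos (σ := σ) hK hL hΦ0 hΦ1
  have h := ((hasDerivAt_cesAggregate_labor (σ := σ) (K := K) (Φ := Φ) hL).rpow_const
    (p := σ / (σ - 1) - 1) (Or.inl hS.ne')).const_mul (A * (K ^ ((σ - 1) / σ - 1) * Φ ^ (1 / σ)))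
  refine (h.congr_of_eventuallyEq ?_).deriv
  filter_upwards [lt_mem_nhds hL] with L' hL'
  exact FK_eq hσ0 hσ1 hK hL' hΦ0 hΦ1

theorem FLΦ_eq {A σ K L Φ : ℝ} (hσ0 : 0 < σ) (hσ1 : σ < 1)
    (hK : 0 < K) (hL : 0 < L) (hΦ0 : 0 < Φ) (hΦ1 : Φ < 1) :
    FLΦ A σ K L Φ = A * L ^ ((σ - 1) / σ - 1)
      * (-(1 / σ * (1 - Φ) ^ (1 / σ - 1)) * cesAggregate σ K L Φ ^ (σ / (σ - 1) - 1)
        + (1 - Φ) ^ (1 / σ) * ((K ^ ((σ - 1) / σ) * (1 / σ * Φ ^ (1 / σ - 1))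
          + L ^ ((σ - 1) / σ) * -(1 / σ * (1 - Φ) ^ (1 / σ - 1))) * (σ / (σ - 1) - 1)
            * cesAggregate σ K L Φ ^ (σ / (σ - 1) - 1 - 1))) := by
  have hS := cesAggregate_pos (σ := σ) hK hL hΦ0 hΦ1
  have h := ((hasDerivAt_one_sub_rpow hΦ1 (1 / σ)).mul
    ((hasDerivAt_cesAggregate_share (σ := σ) (K := K) (L := L) hΦ0 hΦ1).rpow_const
      (p := σ / (σ - 1) - 1) (Or.inl hS.ne'))).const_mul (A * L ^ ((σ - 1) / σ - 1))
  refine (h.congr_of_eventuallyEq ?_).deriv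
  filter_upwards [lt_mem_nhds hΦ0, gt_mem_nhds hΦ1] with Φ' h0 h1
  exact FL_eq hσ0 hσ1 hK hL h0 h1

theorem intensity_ratio_rpow {σ K L Φ : ℝ} (hσ0 : 0 < σ)
    (hK : 0 < K) (hL : 0 < L) (hΦ0 : 0 < Φ) (hΦ1 : Φ < 1) :
    ((K / Φ) / (L / (1 - Φ))) ^ ((1 - σ) / σ)
      = (L ^ ((σ - 1) / σ) * (1 - Φ) ^ (1 / σ) * Φ)
        / (K ^ ((σ - 1) / σ) * Φ ^ (1 / σ) * (1 - Φ)) := by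
  have h1 : 0 < 1 - Φ := sub_pos.2 hΦ1
  have hq : 1 / σ = 1 - (σ - 1) / σ := by field_simp; ring
  have hp : (1 - σ) / σ = -((σ - 1) / σ) := by ring
  rw [hq, hp, Real.rpow_sub h1, Real.rpow_sub hΦ0, Real.rpow_neg (by positivity),
    Real.div_rpow (by positivity) (by positivity), Real.div_rpow hK.le hΦ0.le,
    Real.div_rpow hL.le h1.le, Real.rpow_one, Real.rpow_one]
  field_simp

theorem stmt12 (A σ K L Φ : ℝ) (hA : 0 < A) (hσ0 : 0 < σ) (hσ1 : σ < 1)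
    (hK : 0 < K) (hL : 0 < L) (hΦ0 : 0 < Φ) (hΦ1 : Φ < 1) :
    FLΦ A σ K L Φ
      = ((σ / (1 - σ)) * ((K / Φ) / (L / (1 - Φ))) ^ ((1 - σ) / σ)
          - (Φ / (1 - Φ) + 1 / (1 - σ)))
        * (K / Φ) * FKL A σ K L Φ := by
  have h1 : 0 < 1 - Φ := sub_pos.2 hΦ1
  have hs : 1 - σ ≠ 0 := (sub_pos.2 hσ1).ne'
  have hs' : σ - 1 = -(1 - σ) := by ring
  have hS := cesAggregate_pos (σ := σ) hK hL hΦ0 hΦ1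
  have hc : σ / (σ - 1) - 1 = -(1 / (1 - σ)) := by rw [hs']; field_simp; ring
  have hpow : cesAggregate σ K L Φ ^ (σ / (σ - 1) - 1)
      = cesAggregate σ K L Φ ^ (σ / (σ - 1) - 1 - 1)
        * (K ^ ((σ - 1) / σ) * Φ ^ (1 / σ) + L ^ ((σ - 1) / σ) * (1 - Φ) ^ (1 / σ)) := by
    rw [Real.rpow_sub_one hS.ne' (σ / (σ - 1) - 1)]
    exact (div_mul_cancel₀ _ hS.ne').symm
  rw [FLΦ_eq hσ0 hσ1 hK hL hΦ0 hΦ1, FKL_eq hσ0 hσ1 hK hL hΦ0 hΦ1,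
    intensity_ratio_rpow hσ0 hK hL hΦ0 hΦ1, hpow, Real.rpow_sub_one hK.ne',
    Real.rpow_sub_one hL.ne', Real.rpow_sub_one hΦ0.ne', Real.rpow_sub_one h1.ne']
  generalize cesAggregate σ K L Φ ^ (σ / (σ - 1) - 1 - 1) = T
  rw [hc]
  have hX := Real.rpow_pos_of_pos hK ((σ - 1) / σ)
  have hU := Real.rpow_pos_of_pos hΦ0 (1 / σ)
  generalize K ^ ((σ - 1) / σ) = X at *
  generalize L ^ ((σ - 1) / σ) = Y at *
  generalize Φ ^ (1 / σ) = U at *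
  generalize (1 - Φ) ^ (1 / σ) = V at *
  field_simp
  ring
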